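/- Let A ⊆ B be maximally L-positive (hence closed). Then the following are equivalent: (a) A is an r_L-dense L-positive subset of B; (b) Φ_A is touching; (c) A is a stably r_L-dense L-positive subset of B; (d) (Φ_A)* ≥ s_L on B*. -/

import Mathlib

noncomputable section

variable {B : Type*} [NormedAddCommGroup B] [NormedSpace ℝ B]

/-- The quadratic form `q_L b = (1/2)⟨b, Lb⟩` of a Banach SN space. -/
def qL (L : B →L[ℝ] (B →L[ℝ] ℝ)) (b : B) : ℝ := (1 / 2) * L b b

/-- `r_L = (1/2)‖·‖² + q_L`. -/
def rL (L : B →L[ℝ] (B →L[ℝ] ℝ)) (b : B) : ℝ := (1 / 2) * ‖b‖ ^ 2 + qL L b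

/-- `L` is an SN map: `‖L‖ ≤ 1` and `⟨b, Lc⟩ = ⟨c, Lb⟩`. -/
def IsSN (L : B →L[ℝ] (B →L[ℝ] ℝ)) : Prop := ‖L‖ ≤ 1 ∧ ∀ b c : B, L c b = L b c

/-- `f` is a proper convex function `B → (-∞, ∞]` with `f ≥ q_L` on `B`. -/
def PCq (L : B →L[ℝ] (B →L[ℝ] ℝ)) (f : B → EReal) : Prop :=
  (∃ b, f b ≠ ⊤) ∧
  (∀ x y : B, ∀ t : ℝ, 0 ≤ t → t ≤ 1 →
    f (t • x + (1 - t) • y) ≤ (t : EReal) * f x + ((1 - t : ℝ) : EReal) * f y) ∧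
  ∀ b, (qL L b : EReal) ≤ f b

/-- The Fenchel conjugate `f*(b*) = sup_b [⟨b, b*⟩ - f b]`. -/
def fconj (f : B → EReal) (p : B →L[ℝ] ℝ) : EReal := ⨆ b : B, ((p b : ℝ) : EReal) - f b

/-- `f⊛(b) := f*(Lb)`. -/
def fconjL (L : B →L[ℝ] (B →L[ℝ] ℝ)) (f : B → EReal) (b : B) : EReal := fconj f (L b)

/-- `A` is an `L`-positive subset of `B`. -/
def LPositive (L : B →L[ℝ] (B →L[ℝ] ℝ)) (A : Set B) : Prop :=
  A.Nonempty ∧ ∀ a ∈ A, ∀ c ∈ A, 0 ≤ qL L (a - c)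

/-- `A` is maximally `L`-positive. -/
def MaxLPositive (L : B →L[ℝ] (B →L[ℝ] ℝ)) (A : Set B) : Prop :=
  LPositive L A ∧ ∀ A' : Set B, LPositive L A' → A ⊆ A' → A' = A

/-- `A` is `r_L`-dense in `B`: for all `c`, `inf_{a ∈ A} r_L(a - c) ≤ 0`. -/
def RDense (L : B →L[ℝ] (B →L[ℝ] ℝ)) (A : Set B) : Prop :=
  ∀ c : B, (⨅ a ∈ A, ((rL L (a - c) : ℝ) : EReal)) ≤ 0

/-- `A` is stably `r_L`-dense in `B`. -/
def StablyRDense (L : B →L[ℝ] (B →L[ℝ] ℝ)) (A : Set B) : Prop :=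
  ∀ c : B, ∃ K : ℝ, 0 ≤ K ∧
    (⨅ a ∈ {a ∈ A | ‖a - c‖ ≤ K}, ((rL L (a - c) : ℝ) : EReal)) ≤ 0

/-- `f` is touching. -/
def Touching (L : B →L[ℝ] (B →L[ℝ] ℝ)) (f : B → EReal) : Prop :=
  PCq L f ∧
    ∀ c : B, (⨅ d : B, ((f d - (qL L d : EReal)) + ((rL L (d - c) : ℝ) : EReal))) ≤ 0

/-- The function `s_L` on `B*`. -/
def sL (L : B →L[ℝ] (B →L[ℝ] ℝ)) (p : B →L[ℝ] ℝ) : EReal :=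
  ⨆ c : B, ((p c - qL L c - (1 / 2) * ‖L c - p‖ ^ 2 : ℝ) : EReal)

/-- The Fitzpatrick-type function `Φ_A`. -/
def PhiA (L : B →L[ℝ] (B →L[ℝ] ℝ)) (A : Set B) (b : B) : EReal :=
  ⨆ a ∈ A, ((L b a - qL L a : ℝ) : EReal)

/-- `Θ_A` on `B*`. -/
def ThetaA (L : B →L[ℝ] (B →L[ℝ] ℝ)) (A : Set B) (p : B →L[ℝ] ℝ) : EReal :=
  ⨆ a ∈ A, ((p a - qL L a : ℝ) : EReal)

/-- The pair `(b, t)` lies in the epigraph of `Φ_A`, expressed with real inequalities only. -/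
def MemEpiPhi (L : B →L[ℝ] (B →L[ℝ] ℝ)) (A : Set B) (b : B) (t : ℝ) : Prop :=
  ∀ a ∈ A, L b a - qL L a ≤ t

section Quadratic

variable {L : B →L[ℝ] (B →L[ℝ] ℝ)}

lemma qL_add (hL : IsSN L) (a b : B) : qL L (a + b) = qL L a + L a b + qL L b := by
  have := hL.2 a b
  simp only [qL, map_add, add_apply]
  linarith

lemma qL_sub (hL : IsSN L) (a b : B) : qL L (a - b) = qL L a - L b a + qL L b := by
  have := hL.2 a b
  simp only [qL, map_sub, sub_apply]
  linarith

lemma qL_sub_comm (a b : B) : qL L (a - b) = qL L (b - a) := by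
  rw [← neg_sub b a]
  simp only [qL, map_neg, neg_apply, neg_neg]

lemma abs_apply_le (hL : IsSN L) (a b : B) : |L a b| ≤ ‖a‖ * ‖b‖ := by
  calc |L a b| ≤ ‖L‖ * ‖a‖ * ‖b‖ := L.le_opNorm₂ a b
    _ ≤ 1 * ‖a‖ * ‖b‖ := by gcongr; exact hL.1
    _ = ‖a‖ * ‖b‖ := by ring

lemma rL_nonneg (hL : IsSN L) (b : B) : 0 ≤ rL L b := by
  have := abs_le.1 (abs_apply_le hL b b)
  simp only [rL, qL]
  nlinarith

lemma rL_add_le (hL : IsSN L) (a b : B) :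
    rL L (a + b) ≤ rL L a + 2 * ‖a‖ * ‖b‖ + ‖b‖ ^ 2 := by
  have h1 := abs_le.1 (abs_apply_le hL a b)
  have h2 := abs_le.1 (abs_apply_le hL b b)
  have h3 : ‖a + b‖ ^ 2 ≤ (‖a‖ + ‖b‖) ^ 2 := by gcongr; exact norm_add_le a b
  have h4 : qL L b ≤ (1 / 2) * ‖b‖ ^ 2 := by simp only [qL]; nlinarith
  rw [rL, rL, qL_add hL]
  nlinarith

lemma continuous_qL (L : B →L[ℝ] (B →L[ℝ] ℝ)) : Continuous (qL L) := by
  unfold qL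
  fun_prop

end Quadratic

section Epigraph

variable {L : B →L[ℝ] (B →L[ℝ] ℝ)} {A : Set B}

lemma PhiA_le_coe_iff {b : B} {t : ℝ} : PhiA L A b ≤ (t : EReal) ↔ MemEpiPhi L A b t := by
  simp only [PhiA, MemEpiPhi, iSup_le_iff, EReal.coe_le_coe_iff]

lemma le_PhiA {a : B} (ha : a ∈ A) (b : B) : ((L b a - qL L a : ℝ) : EReal) ≤ PhiA L A b :=
  le_iSup₂ (f := fun a (_ : a ∈ A) => ((L b a - qL L a : ℝ) : EReal)) a ha

lemma PhiA_ne_bot (hA : A.Nonempty) (b : B) : PhiA L A b ≠ ⊥ := by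
  obtain ⟨a, ha⟩ := hA
  exact ne_bot_of_le_ne_bot (EReal.coe_ne_bot _) (le_PhiA ha b)

lemma MemEpiPhi.convexComb {x y : B} {s t u v : ℝ} (hx : MemEpiPhi L A x s)
    (hy : MemEpiPhi L A y t) (hu : 0 ≤ u) (hv : 0 ≤ v) (huv : u + v = 1) :
    MemEpiPhi L A (u • x + v • y) (u * s + v * t) := by
  intro a ha
  have h1 := mul_le_mul_of_nonneg_left (hx a ha) hu
  have h2 := mul_le_mul_of_nonneg_left (hy a ha) hv
  have h3 : qL L a = u * qL L a + v * qL L a := by rw [← add_mul, huv, one_mul]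
  simp only [map_add, map_smul, add_apply, smul_apply,
    smul_eq_mul]
  linarith

lemma MemEpiPhi.neg_qL_sub_le (hL : IsSN L) {b a : B} {t : ℝ} (h : MemEpiPhi L A b t)
    (ha : a ∈ A) : -(t - qL L b) ≤ qL L (a - b) := by
  have := h a ha
  rw [qL_sub hL]
  linarith

lemma memEpiPhi_self (hL : IsSN L) (hA : LPositive L A) {a : B} (ha : a ∈ A) :
    MemEpiPhi L A a (qL L a) := by
  intro b hb
  have := hA.2 b hb a ha
  rw [qL_sub hL] at this
  linarith

lemma MaxLPositive.mem_of_forall (hA : MaxLPositive L A) {c : B}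
    (hc : ∀ a ∈ A, 0 ≤ qL L (a - c)) : c ∈ A := by
  have hpos : LPositive L (insert c A) := by
    refine ⟨Set.insert_nonempty _ _, ?_⟩
    rintro a (rfl | ha) b (rfl | hb)
    · simp [qL]
    · rw [qL_sub_comm]
      exact hc b hb
    · exact hc a ha
    · exact hA.1.2 a ha b hb
  rw [← hA.2 _ hpos (Set.subset_insert c A)]
  exact Set.mem_insert c A

lemma MemEpiPhi.qL_le (hL : IsSN L) (hA : MaxLPositive L A) {b : B} {t : ℝ}
    (h : MemEpiPhi L A b t) : qL L b ≤ t := by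
  by_contra! hlt
  have hb : b ∈ A := hA.mem_of_forall fun a ha => by
    have := h.neg_qL_sub_le hL ha
    linarith
  have := h.neg_qL_sub_le hL hb
  simp [qL] at this hlt
  linarith

lemma MemEpiPhi.neg_qL_sub_le_two_mul (hL : IsSN L) (hA : MaxLPositive L A) {x y : B} {s t : ℝ}
    (hx : MemEpiPhi L A x s) (hy : MemEpiPhi L A y t) :
    -qL L (x - y) ≤ 2 * (s - qL L x) + 2 * (t - qL L y) := by
  have h := (hx.convexComb hy (u := 1 / 2) (v := 1 / 2) (by norm_num) (by norm_num)
    (by norm_num)).qL_le hL hA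
  have h2 := hL.2 x y
  rw [qL_add hL] at h
  rw [qL_sub hL]
  simp only [qL, map_smul, smul_apply, smul_eq_mul] at *
  linarith

lemma pcq_PhiA (hL : IsSN L) (hA : MaxLPositive L A) : PCq L (PhiA L A) := by
  refine ⟨?_, ?_, ?_⟩
  · obtain ⟨a, ha⟩ := hA.1.1
    exact ⟨a, ne_top_of_le_ne_top (EReal.coe_ne_top _)
      (PhiA_le_coe_iff.2 (memEpiPhi_self hL hA.1 ha))⟩
  · intro x y t ht0 ht1
    refine iSup₂_le fun a ha => ?_
    have hsplit : L (t • x + (1 - t) • y) a - qL L a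
        = t * (L x a - qL L a) + (1 - t) * (L y a - qL L a) := by
      simp only [map_add, map_smul, add_apply,
        smul_apply, smul_eq_mul]
      ring
    rw [hsplit, EReal.coe_add, EReal.coe_mul, EReal.coe_mul]
    have h0 : (0 : EReal) ≤ (t : EReal) := by exact_mod_cast ht0
    have h1 : (0 : EReal) ≤ ((1 - t : ℝ) : EReal) := by
      exact_mod_cast sub_nonneg.2 ht1
    exact add_le_add (mul_le_mul_of_nonneg_left (le_PhiA ha x) h0)
      (mul_le_mul_of_nonneg_left (le_PhiA ha y) h1)
  · intro b
    refine EReal.le_of_forall_lt_iff_le.1 fun t ht => ?_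
    exact EReal.coe_le_coe_iff.2 ((PhiA_le_coe_iff.1 ht.le).qL_le hL hA)

end Epigraph

section RealForms

variable {L : B →L[ℝ] (B →L[ℝ] ℝ)} {A : Set B}

lemma iInf_mem_coe_le_zero_iff {α : Type*} {S : Set α} {g : α → ℝ} :
    (⨅ a ∈ S, ((g a : ℝ) : EReal)) ≤ 0 ↔ ∀ ε > 0, ∃ a ∈ S, g a < ε := by
  constructor
  · intro h ε hε
    have hlt : (⨅ a ∈ S, ((g a : ℝ) : EReal)) < (ε : EReal) :=
      h.trans_lt (by exact_mod_cast hε)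
    simpa only [iInf_lt_iff, EReal.coe_lt_coe_iff, exists_prop] using hlt
  · intro h
    refine EReal.le_of_forall_lt_iff_le.1 fun ε hε => ?_
    obtain ⟨a, ha, hlt⟩ := h ε (by exact_mod_cast hε)
    exact (iInf₂_le a ha).trans (EReal.coe_le_coe_iff.2 hlt.le)

lemma iInf_PhiA_le_zero_iff (hA : A.Nonempty) (c : B) :
    (⨅ d : B, ((PhiA L A d - (qL L d : EReal)) + ((rL L (d - c) : ℝ) : EReal))) ≤ 0 ↔
      ∀ ε > 0, ∃ d t, MemEpiPhi L A d t ∧ t - qL L d + rL L (d - c) < ε := by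
  constructor
  · intro h ε hε
    obtain ⟨d, hd⟩ := iInf_lt_iff.1 (h.trans_lt (show (0 : EReal) < (ε : EReal) by
      exact_mod_cast hε))
    have hbot := PhiA_ne_bot (L := L) hA d
    have htop : PhiA L A d ≠ ⊤ := by
      intro htop
      rw [htop, EReal.top_sub_coe, EReal.top_add_coe] at hd
      exact not_top_lt hd
    lift PhiA L A d to ℝ using ⟨htop, hbot⟩ with t ht
    exact ⟨d, t, PhiA_le_coe_iff.1 ht.ge, by exact_mod_cast hd⟩
  · intro h
    refine EReal.le_of_forall_lt_iff_le.1 fun ε hε => ?_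
    obtain ⟨d, t, hdt, hlt⟩ := h ε (by exact_mod_cast hε)
    refine (iInf_le _ d).trans ?_
    calc PhiA L A d - (qL L d : EReal) + ((rL L (d - c) : ℝ) : EReal)
        ≤ (t : EReal) - (qL L d : EReal) + ((rL L (d - c) : ℝ) : EReal) :=
          add_le_add_left (EReal.sub_le_sub (PhiA_le_coe_iff.2 hdt) le_rfl) _
      _ ≤ (ε : EReal) := by exact_mod_cast hlt.le

end RealForms

section Implications

variable {L : B →L[ℝ] (B →L[ℝ] ℝ)} {A : Set B}

lemma StablyRDense.rDense (h : StablyRDense L A) : RDense L A := by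
  intro c
  obtain ⟨K, -, hK⟩ := h c
  exact (biInf_mono fun a ha => ha.1).trans hK

lemma RDense.touching (hL : IsSN L) (hA : MaxLPositive L A) (h : RDense L A) :
    Touching L (PhiA L A) := by
  refine ⟨pcq_PhiA hL hA, fun c => (iInf_PhiA_le_zero_iff hA.1.1 c).2 fun ε hε => ?_⟩
  obtain ⟨a, ha, hlt⟩ := iInf_mem_coe_le_zero_iff.1 (h c) ε hε
  exact ⟨a, qL L a, memEpiPhi_self hL hA.1 ha, by linarith⟩

lemma RDense.sL_le_fconj (hL : IsSN L) (hA : LPositive L A) (h : RDense L A)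
    (p : B →L[ℝ] ℝ) : sL L p ≤ fconj (PhiA L A) p := by
  refine iSup_le fun c => EReal.ge_of_forall_gt_iff_ge.1 fun z hz => ?_
  rw [EReal.coe_lt_coe_iff] at hz
  obtain ⟨a, ha, hlt⟩ := iInf_mem_coe_le_zero_iff.1 (h c) _ (sub_pos.2 hz)
  have hreal : z ≤ p a - qL L a := by
    have h1 := (abs_le.1 ((L c - p).le_opNorm (a - c))).2
    have h2 := hL.2 a c
    rw [rL, qL_sub hL] at hlt
    simp only [sub_apply, map_sub] at h1
    have h3 : L c c = 2 * qL L c := by simp only [qL]; ring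
    nlinarith [sq_nonneg (‖L c - p‖ - ‖a - c‖)]
  calc (z : EReal) ≤ (p a : EReal) - (qL L a : EReal) := by exact_mod_cast hreal
    _ ≤ (p a : EReal) - PhiA L A a :=
        EReal.sub_le_sub le_rfl (PhiA_le_coe_iff.2 (memEpiPhi_self hL hA ha))
    _ ≤ fconj (PhiA L A) p := le_iSup (fun b => (p b : EReal) - PhiA L A b) a

/-- From a point where `Φ_A - q_L` is small, a touching `Φ_A` lets one move a controlled distance
to a point where it is four times smaller. -/
lemma Touching.exists_improve (hL : IsSN L) (hA : MaxLPositive L A)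
    (h : Touching L (PhiA L A)) {δ : ℝ} (hδ : 0 < δ) {d : B} {t : ℝ} (hd : MemEpiPhi L A d t)
    (ht : t - qL L d ≤ δ ^ 2) :
    ∃ d' t', MemEpiPhi L A d' t' ∧ t' - qL L d' ≤ (δ / 2) ^ 2 ∧ ‖d - d'‖ ≤ 3 * δ := by
  obtain ⟨d', t', hd', hlt⟩ := (iInf_PhiA_le_zero_iff hA.1.1 d).1 (h.2 d) ((δ / 2) ^ 2)
    (by positivity)
  have h1 := rL_nonneg hL (d' - d)
  have h2 := hd'.qL_le hL hA
  have h3 := hd'.neg_qL_sub_le_two_mul hL hA hd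
  refine ⟨d', t', hd', by linarith, ?_⟩
  rw [rL] at h1 hlt
  rw [norm_sub_rev]
  exact abs_le_of_sq_le_sq' (by nlinarith) (by positivity) |>.2

lemma Touching.exists_mem_norm_sub_le [CompleteSpace B] (hL : IsSN L) (hA : MaxLPositive L A)
    (h : Touching L (PhiA L A)) {δ : ℝ} (hδ : 0 < δ) {d : B} {t : ℝ} (hd : MemEpiPhi L A d t)
    (ht : t - qL L d ≤ δ ^ 2) : ∃ a ∈ A, ‖a - d‖ ≤ 6 * δ := by
  have hstep : ∀ (n : ℕ) (x : B × ℝ), ∃ y : B × ℝ,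
      MemEpiPhi L A x.1 x.2 ∧ x.2 - qL L x.1 ≤ (δ / 2 ^ n) ^ 2 →
      (MemEpiPhi L A y.1 y.2 ∧ y.2 - qL L y.1 ≤ (δ / 2 ^ (n + 1)) ^ 2) ∧
        ‖x.1 - y.1‖ ≤ 3 * (δ / 2 ^ n) := by
    intro n x
    by_cases hx : MemEpiPhi L A x.1 x.2 ∧ x.2 - qL L x.1 ≤ (δ / 2 ^ n) ^ 2
    · obtain ⟨d', t', h1, h2, h3⟩ := h.exists_improve hL hA (by positivity) hx.1 hx.2
      exact ⟨(d', t'), fun _ => ⟨⟨h1, by rwa [pow_succ 2 n, ← div_div]⟩, h3⟩⟩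
    · exact ⟨x, fun hx' => absurd hx' hx⟩
  choose next hnext using hstep
  let u : ℕ → B × ℝ := fun n => Nat.rec (d, t) next n
  have hu : ∀ n, MemEpiPhi L A (u n).1 (u n).2 ∧
      (u n).2 - qL L (u n).1 ≤ (δ / 2 ^ n) ^ 2 := by
    intro n
    induction n with
    | zero => exact ⟨hd, by simpa [u] using ht⟩
    | succ n ih => exact (hnext n (u n) ih).1
  have hdist : ∀ n, dist (u n).1 (u (n + 1)).1 ≤ 6 * δ / 2 / 2 ^ n := by
    intro n
    rw [dist_eq_norm]
    refine (hnext n (u n) (hu n)).2.trans_eq ?_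
    ring
  obtain ⟨a, ha⟩ := cauchySeq_tendsto_of_complete (cauchySeq_of_le_geometric_two hdist)
  refine ⟨a, hA.mem_of_forall fun b hb => ?_, ?_⟩
  · have hlim1 : Filter.Tendsto (fun n => qL L (b - (u n).1)) Filter.atTop
        (nhds (qL L (b - a))) :=
      ((continuous_qL L).tendsto _).comp (ha.const_sub b)
    have hlim2 : Filter.Tendsto (fun n : ℕ => -(δ / 2 ^ n) ^ 2) Filter.atTop (nhds 0) := by
      have h0 : Filter.Tendsto (fun n : ℕ => δ / (2 : ℝ) ^ n) Filter.atTop (nhds 0) :=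
        Filter.Tendsto.const_div_atTop (tendsto_pow_atTop_atTop_of_one_lt one_lt_two) δ
      simpa using (h0.pow 2).neg
    refine le_of_tendsto_of_tendsto' hlim2 hlim1 fun n => ?_
    have := (hu n).1.neg_qL_sub_le hL hb
    linarith [(hu n).2]
  · have := dist_le_of_le_geometric_two_of_tendsto₀ hdist ha
    rwa [dist_comm, dist_eq_norm] at this

lemma Touching.stablyRDense [CompleteSpace B] (hL : IsSN L) (hA : MaxLPositive L A)
    (h : Touching L (PhiA L A)) : StablyRDense L A := by
  intro c
  obtain ⟨a₀, ha₀⟩ := hA.1.1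
  set M := ‖a₀ - c‖ with hM
  have hM0 : 0 ≤ M := norm_nonneg _
  refine ⟨3 * M + 8, by positivity, iInf_mem_coe_le_zero_iff.2 fun ε hε => ?_⟩
  obtain ⟨δ, hδ, hδ1, hδε⟩ : ∃ δ : ℝ, 0 < δ ∧ δ ≤ 1 ∧ δ * (62 + 36 * M) ≤ ε :=
    ⟨min 1 (ε / (62 + 36 * M)), by positivity, min_le_left _ _,
      (le_div_iff₀ (by positivity)).1 (min_le_right _ _)⟩
  obtain ⟨d, t, hd, hlt⟩ := (iInf_PhiA_le_zero_iff hA.1.1 c).1 (h.2 c) (δ ^ 2) (by positivity)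
  have hr := rL_nonneg hL (d - c)
  have hqt := hd.qL_le hL hA
  obtain ⟨a, ha, hda⟩ := h.exists_mem_norm_sub_le hL hA hδ hd (by linarith)
  have hN : ‖d - c‖ ≤ 3 * M + 2 := by
    have h1 := hd.neg_qL_sub_le hL ha₀
    have h2 : qL L (d - c) = qL L (d - a₀) + L (d - a₀) (a₀ - c) + qL L (a₀ - c) := by
      rw [← qL_add hL, sub_add_sub_cancel]
    have h3 := (abs_le.1 (abs_apply_le hL (d - a₀) (a₀ - c))).1
    have h4 := rL_nonneg hL (a₀ - c)
    have h5 : ‖d - a₀‖ ≤ ‖d - c‖ + M := by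
      rw [hM, norm_sub_rev a₀ c]
      exact norm_sub_le_norm_sub_add_norm_sub d c a₀
    have h6 : ‖d - a₀‖ * M ≤ (‖d - c‖ + M) * M := mul_le_mul_of_nonneg_right h5 hM0
    rw [rL] at hlt h4
    rw [qL_sub_comm] at h1
    rw [← hM] at h3 h4
    have h7 : (‖d - c‖ - M) ^ 2 ≤ (2 * M + 2) ^ 2 := by nlinarith
    linarith [(abs_le_of_sq_le_sq' h7 (by positivity)).2]
  have hac : (d - c) + (a - d) = a - c := by abel
  refine ⟨a, ⟨ha, ?_⟩, ?_⟩
  · rw [← hac]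
    exact (norm_add_le _ _).trans (by linarith)
  · have h1 := rL_add_le hL (d - c) (a - d)
    rw [hac] at h1
    have h2 : ‖d - c‖ * ‖a - d‖ ≤ (3 * M + 2) * (6 * δ) := by gcongr
    have h3 : ‖a - d‖ ^ 2 ≤ (6 * δ) ^ 2 := by gcongr
    nlinarith

/-- The conjugate of `½‖·‖²` is at least `½‖·‖²`. -/
lemma half_norm_sq_le_of_forall {φ : B →L[ℝ] ℝ} {k : ℝ}
    (h : ∀ x, φ x - (1 / 2) * ‖x‖ ^ 2 ≤ k) : (1 / 2) * ‖φ‖ ^ 2 ≤ k := by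
  have hk : 0 ≤ k := by simpa using h 0
  have hle : ‖φ‖ ≤ √(2 * k) := by
    refine φ.opNorm_le_bound (Real.sqrt_nonneg _) fun x => ?_
    have hd := discrim_le_zero (a := (1 / 2) * ‖x‖ ^ 2) (b := -φ x) (c := k) fun s => by
      have := h (s • x)
      rw [norm_smul, mul_pow, Real.norm_eq_abs, sq_abs, map_smul, smul_eq_mul] at this
      nlinarith
    rw [discrim] at hd
    rw [Real.norm_eq_abs]
    refine abs_le_of_sq_le_sq ?_ (by positivity)
    rw [mul_pow, Real.sq_sqrt (by positivity)]
    nlinarith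
  have := pow_le_pow_left₀ (norm_nonneg φ) hle 2
  rw [Real.sq_sqrt (by positivity)] at this
  linarith

/-- A sandwich theorem: a convex epigraph lying above `m - ½‖· - c‖²` can be separated from it by a
continuous affine function. -/
lemma exists_affine_between {E : Set (B × ℝ)} (hE : Convex ℝ E) (hne : E.Nonempty) {c : B}
    {m : ℝ} (h : ∀ x ∈ E, m - (1 / 2) * ‖x.1 - c‖ ^ 2 ≤ x.2) :
    ∃ (φ : B →L[ℝ] ℝ) (u : ℝ), (1 / 2) * ‖φ‖ ^ 2 ≤ u - m ∧
      ∀ x ∈ E, u ≤ φ (x.1 - c) + x.2 := by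
  let S : Set (B × ℝ) := {x | x.2 < m - (1 / 2) * ‖x.1 - c‖ ^ 2}
  have hSo : IsOpen S := isOpen_lt (by fun_prop) (by fun_prop)
  have hnorm : ConvexOn ℝ Set.univ fun x : B => ‖x - c‖ ^ 2 := by
    have h1 : ConvexOn ℝ Set.univ fun x : B => ‖x - c‖ := by
      simpa only [dist_eq_norm] using convexOn_univ_dist c
    exact h1.pow (fun _ _ => norm_nonneg _) 2
  have hSc : Convex ℝ S := by
    intro x hx y hy a b ha hb hab
    have h1 := hnorm.2 (Set.mem_univ x.1) (Set.mem_univ y.1) ha hb hab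
    simp only [S, Set.mem_ofPred_eq, Prod.fst_add, Prod.snd_add, Prod.smul_fst, Prod.smul_snd,
      smul_eq_mul] at *
    have hm : m = a * m + b * m := by rw [← add_mul, hab, one_mul]
    rcases ha.eq_or_lt with rfl | ha'
    · obtain rfl : b = 1 := by linarith
      linarith
    · have h2 := mul_lt_mul_of_pos_left hx ha'
      have h3 := mul_le_mul_of_nonneg_left hy.le hb
      linarith
  have hdisj : Disjoint S E := Set.disjoint_left.2 fun x hx hxE =>
    absurd (h x hxE) (not_le.2 hx)
  obtain ⟨F, u, hFS, hFE⟩ := geometric_hahn_banach_open hSc hSo hE hdisj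
  set ψ : B →L[ℝ] ℝ := F.comp (ContinuousLinearMap.inl ℝ B ℝ) with hψ
  set s : ℝ := F (0, 1) with hs
  have hF : ∀ (x : B) (t : ℝ), F (x, t) = ψ x + s * t := by
    intro x t
    have : ((x, t) : B × ℝ) = (x, 0) + t • ((0, 1) : B × ℝ) := by simp
    rw [this, map_add, map_smul, smul_eq_mul, mul_comm, hψ, hs]
    rfl
  have hlow : ∀ (x : B) (t : ℝ), t < m - (1 / 2) * ‖x - c‖ ^ 2 → ψ x + s * t < u :=
    fun x t hx => hF x t ▸ hFS (x, t) hx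
  obtain ⟨e, he⟩ := hne
  have hes : u ≤ ψ e.1 + s * e.2 := hF e.1 e.2 ▸ hFE e he
  have hspos : 0 < s := by
    have h1 := hlow e.1 (m - (1 / 2) * ‖e.1 - c‖ ^ 2 - 1) (by linarith)
    nlinarith [h e he]
  have hlow' : ∀ x : B, ψ x + s * (m - (1 / 2) * ‖x - c‖ ^ 2) ≤ u := by
    intro x
    refine le_of_forall_pos_le_add fun η hη => ?_
    have h1 := hlow x (m - (1 / 2) * ‖x - c‖ ^ 2 - η / s) (by linarith [div_pos hη hspos])
    have h2 : s * (η / s) = η := by field_simp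
    nlinarith
  refine ⟨s⁻¹ • ψ, s⁻¹ * (u - ψ c), half_norm_sq_le_of_forall fun x => ?_, fun x hx => ?_⟩
  · have h1 := hlow' (c + x)
    rw [add_sub_cancel_left, map_add] at h1
    have h2 : s⁻¹ * (ψ x + s * (m - (1 / 2) * ‖x‖ ^ 2)) ≤ s⁻¹ * (u - ψ c) :=
      mul_le_mul_of_nonneg_left (by linarith) (by positivity)
    rw [mul_add, inv_mul_cancel_left₀ hspos.ne'] at h2
    rw [smul_apply, smul_eq_mul]
    linarith
  · have h1 : u ≤ ψ x.1 + s * x.2 := hF x.1 x.2 ▸ hFE x hx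
    have h2 : s⁻¹ * (u - ψ c) ≤ s⁻¹ * (ψ (x.1 - c) + s * x.2) :=
      mul_le_mul_of_nonneg_left (by rw [map_sub]; linarith) (by positivity)
    rw [mul_add, inv_mul_cancel_left₀ hspos.ne'] at h2
    rwa [smul_apply, smul_eq_mul]

lemma touching_of_sL_le_fconj (hL : IsSN L) (hA : MaxLPositive L A)
    (h : ∀ p : B →L[ℝ] ℝ, sL L p ≤ fconj (PhiA L A) p) : Touching L (PhiA L A) := by
  refine ⟨pcq_PhiA hL hA, fun c => (iInf_PhiA_le_zero_iff hA.1.1 c).2 ?_⟩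
  by_contra! hcon
  obtain ⟨m, hm, hle⟩ := hcon
  let E : Set (B × ℝ) := {x | MemEpiPhi L A x.1 (x.2 + L c x.1 - qL L c)}
  have hEc : Convex ℝ E := by
    intro x hx y hy a b ha hb hab
    have h1 := hx.convexComb hy ha hb hab
    have h2 : qL L c = a * qL L c + b * qL L c := by rw [← add_mul, hab, one_mul]
    simp only [E, Set.mem_ofPred_eq, Prod.fst_add, Prod.snd_add, Prod.smul_fst, Prod.smul_snd,
      smul_eq_mul, map_add, map_smul]
    convert h1 using 1
    linarith
  have hmemE : ∀ d t, MemEpiPhi L A d t → (d, t - L c d + qL L c) ∈ E := by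
    intro d t hdt
    rw [Set.mem_ofPred_eq]
    convert hdt using 1
    ring
  have hEne : E.Nonempty := by
    obtain ⟨a, ha⟩ := hA.1.1
    exact ⟨_, hmemE a _ (memEpiPhi_self hL hA.1 ha)⟩
  obtain ⟨φ, u, hφ, hu⟩ := exists_affine_between hEc hEne (c := c) (m := m) fun x hx => by
    have := hle _ _ hx
    rw [rL, qL_sub hL] at this
    linarith
  have hconj : fconj (PhiA L A) (L c - φ) ≤ ((qL L c - φ c - u : ℝ) : EReal) := by
    refine iSup_le fun d => ?_
    have hbot := PhiA_ne_bot (L := L) hA.1.1 d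
    by_cases htop : PhiA L A d = ⊤
    · simp [htop]
    lift PhiA L A d to ℝ using ⟨htop, hbot⟩ with t ht
    have h1 := hu _ (hmemE d t (PhiA_le_coe_iff.1 ht.ge))
    rw [map_sub] at h1
    have h2 : (L c - φ) d - t ≤ qL L c - φ c - u := by
      rw [sub_apply]
      dsimp only at h1
      linarith
    exact_mod_cast h2
  have hs := (le_iSup (fun x : B => (((L c - φ) x - qL L x
    - (1 / 2) * ‖L x - (L c - φ)‖ ^ 2 : ℝ) : EReal)) c).trans ((h (L c - φ)).trans hconj)
  rw [EReal.coe_le_coe_iff, sub_sub_cancel, sub_apply] at hs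
  have h3 : L c c = 2 * qL L c := by simp only [qL]; ring
  linarith

end Implications

theorem statement6 [CompleteSpace B] [Nontrivial B]
    (L : B →L[ℝ] (B →L[ℝ] ℝ)) (hL : IsSN L)
    (A : Set B) (hA : MaxLPositive L A) :
    ((RDense L A ∧ LPositive L A) ↔ Touching L (PhiA L A)) ∧
    (Touching L (PhiA L A) ↔ (StablyRDense L A ∧ LPositive L A)) ∧
    ((StablyRDense L A ∧ LPositive L A) ↔
      ∀ p : B →L[ℝ] ℝ, sL L p ≤ fconj (PhiA L A) p) := by
  have hab : RDense L A → Touching L (PhiA L A) := fun h => h.touching hL hA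
  have hbc : Touching L (PhiA L A) → StablyRDense L A := fun h => h.stablyRDense hL hA
  have hca : StablyRDense L A → RDense L A := fun h => h.rDense
  refine ⟨⟨fun h => hab h.1, fun h => ⟨hca (hbc h), hA.1⟩⟩,
    ⟨fun h => ⟨hbc h, hA.1⟩, fun h => hab (hca h.1)⟩,
    ⟨fun h p => (hca h.1).sL_le_fconj hL hA.1 p,
      fun h => ⟨hbc (touching_of_sL_le_fconj hL hA h), hA.1⟩⟩⟩
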